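/- arXiv:2002.01853 — 5 statements merged into one kernel-verified Lean document; each statement's English description precedes it below -/
import Mathlib

section
/- Assume e/h is even, 2h < e, and write e = 2m. Let b ∈ F_q^* and let a ∈ F_q^* be a (2^h+1)-th power in F_q^* (i.e., a = c^{2^h+1} for some c ∈ F_q^*). Then |D_{(a,b)}| = q²/2 − 1, and among the q² − 1 pairs (u,v) ≠ (0,0), exactly q² − 2^{e−2h} − 1 pairs satisfy wt(c_{(u,v)}) = q²/4, exactly 2^{e−2h−1} + 2^{m−h−1} pairs satisfy wt(c_{(u,v)}) = (q/4)·(q − 2^{m+h}), and exactly 2^{e−2h−1} − 2^{m−h−1} pairs satisfy wt(c_{(u,v)}) = (q/4)·(q + 2^{m+h}); no other nonzero weights occur. -/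
open Finset

theorem card_filter_pow_eq_self {F : Type*} [Field F] [Fintype F] [DecidableEq F] {p e d : ℕ}
    (hp : p.Prime) (hF : Fintype.card F = p ^ e) (hd : d ∣ e) :
    #{w : F | w ^ p ^ d = w} = p ^ d := by
  have hpos : 1 ≤ p ^ d := Nat.pow_pos hp.pos
  have key : ∀ w : F, w ≠ 0 → (w ^ p ^ d = w ↔ w ^ (p ^ d - 1) = 1) := fun w hw ↦ by
    conv_lhs => rw [← Nat.sub_add_cancel hpos, pow_succ]
    exact mul_eq_right₀ hw
  have hker : #{w : Fˣ | w ^ (p ^ d - 1) = 1} = p ^ d - 1 := by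
    have h := IsCyclic.card_powMonoidHom_ker (G := Fˣ) (p ^ d - 1)
    rw [Nat.card_eq_fintype_card (α := Fˣ), Fintype.card_units, hF,
      Nat.gcd_eq_right (Nat.pow_sub_one_dvd_pow_sub_one p hd)] at h
    rw [← Fintype.card_subtype, ← Nat.card_eq_fintype_card]
    exact h
  have hset : ({w : F | w ^ p ^ d = w} : Finset F) =
      insert 0 (({w : Fˣ | w ^ (p ^ d - 1) = 1} : Finset Fˣ).map ⟨Units.val, Units.val_injective⟩) := by
    ext w
    rcases eq_or_ne w 0 with rfl | hw
    · simp [hp.ne_zero]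
    · simp only [mem_filter, mem_univ, true_and, mem_insert, hw, false_or, mem_map,
        Function.Embedding.coeFn_mk, key w hw]
      exact ⟨fun h ↦ ⟨Units.mk0 w hw, Units.ext (by simpa using h), rfl⟩,
        fun ⟨v, hv, hvw⟩ ↦ by simpa [hvw] using congrArg Units.val hv⟩
  rw [hset, card_insert_of_notMem (by simp), card_map, hker, Nat.sub_add_cancel hpos]

/-- If `f` only takes the values `0` and `± M`, its first two moments determine how often it
takes each of them. -/
theorem card_filter_eq_of_three_valued {ι : Type*} [Fintype ι] [DecidableEq ι] (f : ι → ℤ) {M : ℤ}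
    (hM : M ≠ 0) (hf : ∀ i, f i = 0 ∨ f i = M ∨ f i = -M) :
    M * (#{i | f i = M} - #{i | f i = -M}) = ∑ i, f i ∧
    M ^ 2 * (#{i | f i = M} + #{i | f i = -M}) = ∑ i, f i ^ 2 ∧
    (#{i | f i = 0} + #{i | f i = M} + #{i | f i = -M} : ℤ) = Fintype.card ι := by
  have hM' : M ≠ -M := by omega
  simp only [card_filter, Fintype.card_eq_sum_ones, Nat.cast_sum, ← sum_sub_distrib,
    ← sum_add_distrib, mul_sum]
  refine ⟨sum_congr rfl fun i _ ↦ ?_, sum_congr rfl fun i _ ↦ ?_, sum_congr rfl fun i _ ↦ ?_⟩ <;>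
    rcases hf i with h | h | h <;> simp [h, hM, hM.symm, hM', hM'.symm]

section GoldForm

variable {F : Type*} [Field F] {ψ : AddChar F ℤ}

theorem AddChar.apply_pow_two_pow (hfrob : ∀ x, ψ (x ^ 2) = ψ x) (n : ℕ) (x : F) :
    ψ (x ^ 2 ^ n) = ψ x := by
  induction n with
  | zero => simp
  | succ n ih => rw [pow_succ, pow_mul, hfrob, ih]

/-- The linearized polynomial whose kernel is the radical of the Gold form. -/
def goldRadicalMap (h : ℕ) (a z : F) : F := a * z + a ^ 2 ^ h * z ^ 2 ^ (2 * h)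

theorem apply_polar_goldForm (hfrob : ∀ x, ψ (x ^ 2) = ψ x) (h : ℕ) (a x z : F) :
    ψ (a * z * x ^ 2 ^ h + a * x * z ^ 2 ^ h) = ψ (goldRadicalMap h a z * x ^ 2 ^ h) := by
  rw [AddChar.map_add_eq_mul, ← AddChar.apply_pow_two_pow hfrob h (a * x * _),
    ← AddChar.map_add_eq_mul, goldRadicalMap]
  congr 1
  rw [mul_pow, mul_pow, ← pow_mul, ← pow_add, two_mul]
  ring

variable [CharP F 2]

theorem goldForm_add (h : ℕ) (a u x z : F) :
    a * (x + z) ^ (2 ^ h + 1) + u * (x + z) = (a * x ^ (2 ^ h + 1) + u * x) +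
      (a * z ^ (2 ^ h + 1) + u * z) + (a * z * x ^ 2 ^ h + a * x * z ^ 2 ^ h) := by
  rw [pow_succ, add_pow_char_pow]
  ring

/-- The radical of the Gold form. -/
def goldRadical (h : ℕ) (a : F) : AddSubgroup F where
  carrier := {z | goldRadicalMap h a z = 0}
  zero_mem' := by simp [goldRadicalMap]
  add_mem' {x y} hx hy := by
    simp only [Set.mem_ofPred_eq, goldRadicalMap, add_pow_char_pow] at *
    linear_combination hx + hy
  neg_mem' {x} hx := by simpa [CharTwo.neg_eq] using hx

theorem mem_goldRadical {h : ℕ} {a z : F} : z ∈ goldRadical h a ↔ goldRadicalMap h a z = 0 :=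
  Iff.rfl

end GoldForm

section GoldSum

variable {F : Type*} [Field F] [Fintype F]

/-- The exponential sum of the Gold form `a x ^ (2 ^ h + 1) + u x`. -/
def goldSum (ψ : AddChar F ℤ) (h : ℕ) (a u : F) : ℤ :=
  ∑ x, ψ (a * x ^ (2 ^ h + 1) + u * x)

variable {ψ : AddChar F ℤ}

theorem AddChar.sum_mul_apply_eq_ite [DecidableEq F] (hψ : ψ ≠ 1) (y : F) :
    ∑ x, ψ (y * x) = if y = 0 then (Fintype.card F : ℤ) else 0 := by
  simpa [mul_comm] using AddChar.sum_mulShift y (AddChar.IsPrimitive.of_ne_one hψ)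

theorem sum_goldSum (hψ : ψ ≠ 1) (h : ℕ) (a : F) :
    ∑ u, goldSum ψ h a u = Fintype.card F := by
  classical
  simp only [goldSum]
  rw [sum_comm]
  simp only [AddChar.map_add_eq_mul, ← mul_sum]
  simp_rw [mul_comm _ (_ : F), AddChar.sum_mul_apply_eq_ite hψ]
  simp

variable [CharP F 2]

theorem sum_goldSum_sq (hψ : ψ ≠ 1) (h : ℕ) (a : F) :
    ∑ u, goldSum ψ h a u ^ 2 = (Fintype.card F : ℤ) ^ 2 := by
  classical
  have hsq (u : F) : goldSum ψ h a u ^ 2 =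
      ∑ x, ∑ y, ψ (a * x ^ (2 ^ h + 1) + a * y ^ (2 ^ h + 1)) * ψ ((x + y) * u) := by
    simp only [goldSum, sq, sum_mul_sum, ← AddChar.map_add_eq_mul]
    refine sum_congr rfl fun x _ ↦ sum_congr rfl fun y _ ↦ congrArg ψ (by ring)
  have hxy (x y : F) : x + y = 0 ↔ x = y := CharTwo.add_eq_zero
  simp_rw [hsq]
  rw [sum_comm]
  simp_rw [sum_comm (s := univ (α := F)) (t := univ) (f := fun u y ↦ _ * ψ ((_ + y) * u)),
    ← mul_sum, AddChar.sum_mul_apply_eq_ite hψ, hxy]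
  simp [CharTwo.add_self_eq_zero, sq]

/-- The character of the radical of the Gold form through which the form acts. -/
def goldRadicalChar (hfrob : ∀ x, ψ (x ^ 2) = ψ x) (h : ℕ) (a u : F) :
    AddChar (goldRadical h a) ℤ where
  toFun z := ψ (a * (z : F) ^ (2 ^ h + 1) + u * z)
  map_zero_eq_one' := by simp
  map_add_eq_mul' x z := by
    rw [AddSubgroup.coe_add, goldForm_add, AddChar.map_add_eq_mul, AddChar.map_add_eq_mul,
      apply_polar_goldForm hfrob, mem_goldRadical.1 z.2, zero_mul, AddChar.map_zero_eq_one, mul_one]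

theorem goldSum_sq (hψ : ψ ≠ 1) (hfrob : ∀ x, ψ (x ^ 2) = ψ x) (hsq : ∀ x, ψ x * ψ x = 1)
    (h : ℕ) (a u : F) :
    goldSum ψ h a u ^ 2 = 0 ∨
      goldSum ψ h a u ^ 2 = Fintype.card F * Nat.card (goldRadical h a) := by
  classical
  have hbij : Function.Bijective fun x : F ↦ x ^ 2 ^ h := by
    simpa [← iterateFrobenius_def] using bijective_iterateFrobenius F 2 h
  have hsum (z : F) : ∑ x : F, ψ (goldRadicalMap h a z * x ^ 2 ^ h) =
      if goldRadicalMap h a z = 0 then (Fintype.card F : ℤ) else 0 := by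
    rw [← AddChar.sum_mul_apply_eq_ite hψ]
    exact hbij.sum_comp fun x ↦ ψ (goldRadicalMap h a z * x)
  have key : goldSum ψ h a u ^ 2 = Fintype.card F * ∑ z, goldRadicalChar hfrob h a u z := by
    calc goldSum ψ h a u ^ 2
        = ∑ x, ∑ z, ψ (a * x ^ (2 ^ h + 1) + u * x) *
            ψ (a * (x + z) ^ (2 ^ h + 1) + u * (x + z)) := by
          rw [sq, goldSum, sum_mul]
          refine sum_congr rfl fun x _ ↦ ?_
          rw [mul_sum]
          exact (Fintype.sum_equiv (Equiv.addLeft x) _ _ fun z ↦ rfl).symm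
      _ = ∑ x, ∑ z, ψ (a * z ^ (2 ^ h + 1) + u * z) * ψ (goldRadicalMap h a z * x ^ 2 ^ h) := by
          refine sum_congr rfl fun x _ ↦ sum_congr rfl fun z _ ↦ ?_
          rw [goldForm_add, ψ.map_add_eq_mul _ (a * z * x ^ 2 ^ h + a * x * z ^ 2 ^ h),
            ψ.map_add_eq_mul (a * x ^ (2 ^ h + 1) + u * x) (a * z ^ (2 ^ h + 1) + u * z), apply_polar_goldForm hfrob, ← mul_assoc, ← mul_assoc, hsq, one_mul]
      _ = ∑ z, if goldRadicalMap h a z = 0 then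
            Fintype.card F * ψ (a * z ^ (2 ^ h + 1) + u * z) else 0 := by
          rw [sum_comm]
          refine sum_congr rfl fun z _ ↦ ?_
          rw [← mul_sum, hsum, mul_ite, mul_zero, mul_comm]
      _ = _ := by
          rw [← sum_filter, mul_sum]
          exact sum_subtype (p := fun z ↦ z ∈ goldRadical h a) _ (by simp [mem_goldRadical]) _
  rw [key, AddChar.sum_eq_ite]
  split_ifs <;> simp

theorem card_goldRadical {e h : ℕ} (hF : Fintype.card F = 2 ^ e) (hd : 2 * h ∣ e) {c : F}
    (hc : c ≠ 0) : Nat.card (goldRadical h (c ^ (2 ^ h + 1))) = 2 ^ (2 * h) := by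
  classical
  have hmem (z : F) : z ∈ goldRadical h (c ^ (2 ^ h + 1)) ↔ (c * z) ^ 2 ^ (2 * h) = c * z := by
    have : goldRadicalMap h (c ^ (2 ^ h + 1)) z =
        c ^ 2 ^ h * ((c * z) ^ 2 ^ (2 * h) + c * z) := by
      have hexp : 2 ^ (2 * h) = 2 ^ h * 2 ^ h := by rw [two_mul, pow_add]
      rw [goldRadicalMap, hexp]
      ring
    rw [mem_goldRadical, this, mul_eq_zero, or_iff_right (pow_ne_zero _ hc), CharTwo.add_eq_zero]
  rw [← card_filter_pow_eq_self Nat.prime_two hF hd, Nat.card_eq_fintype_card, Fintype.card_subtype]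
  exact card_bij (fun z _ ↦ c * z) (by simp [hmem]) (by simp [hc])
    fun w hw ↦ ⟨c⁻¹ * w, by simpa [hmem, hc] using hw, by simp [hc]⟩

theorem goldSum_eq {e h m : ℕ} (hF : Fintype.card F = 2 ^ e) (he : e = 2 * m) (hd : 2 * h ∣ e)
    (hψ : ψ ≠ 1) (hfrob : ∀ x, ψ (x ^ 2) = ψ x) (hsq : ∀ x, ψ x * ψ x = 1)
    {c : F} (hc : c ≠ 0) (u : F) :
    goldSum ψ h (c ^ (2 ^ h + 1)) u = 0 ∨ goldSum ψ h (c ^ (2 ^ h + 1)) u = 2 ^ (m + h) ∨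
      goldSum ψ h (c ^ (2 ^ h + 1)) u = -2 ^ (m + h) := by
  refine (goldSum_sq hψ hfrob hsq h (c ^ (2 ^ h + 1)) u).imp (by simp) fun H ↦ ?_
  rw [card_goldRadical hF hd hc, hF] at H
  refine sq_eq_sq_iff_eq_or_eq_neg.1 (H.trans ?_)
  subst he
  push_cast
  ring

end GoldSum

/-- The additive character `x ↦ (-1) ^ Tr x` of a field with `2 ^ e` elements. -/
theorem exists_addChar_trace {F : Type*} [Field F] [Fintype F] [DecidableEq F] [CharP F 2] {e : ℕ}
    (hF : Fintype.card F = 2 ^ e) (Tr : F → F)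
    (hTr : ∀ x, Tr x = ∑ i ∈ range e, x ^ 2 ^ i) :
    (∀ x, Tr x = 0 ∨ Tr x = 1) ∧ ∃ ψ : AddChar F ℤ, ψ ≠ 1 ∧ (∀ x, ψ (x ^ 2) = ψ x) ∧
      ∀ x, ψ x = if Tr x = 0 then 1 else -1 := by
  have hfrob (x : F) : Tr (x ^ 2) = Tr x := by
    have h := sum_range_succ' (fun i ↦ x ^ 2 ^ i) e
    rw [sum_range_succ, ← hF, FiniteField.pow_card, pow_zero, pow_one, add_left_inj] at h
    simp only [hTr, ← pow_mul, ← pow_succ', h]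
  have hsq (x : F) : Tr x ^ 2 = Tr x := by
    refine Eq.trans ?_ (hfrob x)
    rw [hTr, hTr, sum_pow_char]
    simp only [← pow_mul, mul_comm]
  have h01 (x : F) : Tr x = 0 ∨ Tr x = 1 := by
    have : Tr x * (Tr x - 1) = 0 := by linear_combination hsq x
    simpa [sub_eq_zero] using this
  have hadd (x y : F) : Tr (x + y) = Tr x + Tr y := by
    simp only [hTr, add_pow_char_pow, sum_add_distrib]
  have hne : ∃ x, Tr x ≠ 0 := by
    let _ := ZMod.algebra F 2
    have hfin : Module.finrank (ZMod 2) F = e := by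
      have := Module.card_eq_pow_finrank (K := ZMod 2) (V := F)
      rw [hF, ZMod.card] at this
      exact (Nat.pow_right_injective le_rfl this).symm
    obtain ⟨x, hx⟩ := Algebra.trace_surjective (ZMod 2) F 1
    refine ⟨x, fun h ↦ ?_⟩
    have := FiniteField.algebraMap_trace_eq_sum_pow (ZMod 2) F x
    rw [hx, hfin, Nat.card_zmod, ← hTr, h] at this
    simp at this
  refine ⟨h01, ⟨fun x ↦ if Tr x = 0 then 1 else -1, by simp [hTr], fun x y ↦ ?_⟩, ?_, ?_, ?_⟩
  · rw [hadd]
    rcases h01 x with hx | hx <;> rcases h01 y with hy | hy <;>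
      simp [hx, hy, CharTwo.add_self_eq_zero]
  · obtain ⟨x, hx⟩ := hne
    exact AddChar.ne_one_iff.2 ⟨x, by simp [hx]⟩
  · exact fun x ↦ by simp [hfrob]
  · exact fun x ↦ rfl

theorem AddChar.sum_prod_apply_add_mul {F : Type*} [Field F] [Fintype F] [DecidableEq F]
    {ψ : AddChar F ℤ} (hψ : ψ ≠ 1) (f : F → F) (v : F) :
    ∑ p : F × F, ψ (f p.1 + v * p.2) =
      if v = 0 then Fintype.card F * ∑ x, ψ (f x) else 0 := by
  simp only [Fintype.sum_prod_type, AddChar.map_add_eq_mul, ← mul_sum,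
    AddChar.sum_mul_apply_eq_ite hψ, ← sum_mul]
  split_ifs <;> ring

/-- Theorem 3(ii): `e/h` even, `2h < e`, `e = 2m`, `b ≠ 0`, `a` a `(2^h+1)`-th power. Then
`|D_{(a,b)}| = q²/2 − 1` and the weight distribution is:
`q² − 2^{e−2h} − 1` codewords of weight `q²/4`, `2^{e−2h−1} + 2^{m−h−1}` of weight
`(q/4)(q − 2^{m+h})`, and `2^{e−2h−1} − 2^{m−h−1}` of weight `(q/4)(q + 2^{m+h})`;
no other nonzero weights occur. -/
theorem stmt_12
    (e h m : ℕ) (hdvd : h ∣ e) (hh0 : 0 < h) (hhe : h < e) (h2h : 2 * h < e)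
    (heven : Even (e / h)) (hm : e = 2 * m)
    (F : Type) [Field F] [Fintype F] [DecidableEq F]
    (hF : Fintype.card F = 2 ^ e)
    (q : ℤ) (hq : q = 2 ^ e)
    (Tr : F → F) (hTr : ∀ x, Tr x = ∑ i ∈ Finset.range e, x ^ 2 ^ i)
    (a b : F) (ha : a ≠ 0) (hb : b ≠ 0)
    (c : F) (hc : c ≠ 0) (hac : a = c ^ (2 ^ h + 1))
    (D : Finset (F × F))
    (hD : D = Finset.univ.filter fun p : F × F =>
        p ≠ (0, 0) ∧ Tr (a * p.1 ^ (2 ^ h + 1) + b * p.2) = 0)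
    (wt : F × F → ℕ)
    (hwt : ∀ u v : F, wt (u, v) =
        (D.filter fun p => Tr (u * p.1 + v * p.2) = 1).card) :
    ((D.card : ℤ) = q ^ 2 / 2 - 1) ∧
    (((Finset.univ.filter fun uv : F × F =>
        uv ≠ (0, 0) ∧ (wt uv : ℤ) = q ^ 2 / 4).card : ℤ)
      = q ^ 2 - 2 ^ (e - 2 * h) - 1) ∧
    (((Finset.univ.filter fun uv : F × F =>
        uv ≠ (0, 0) ∧ (wt uv : ℤ) = q / 4 * (q - 2 ^ (m + h))).card : ℤ)
      = 2 ^ (e - 2 * h - 1) + 2 ^ (m - h - 1)) ∧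
    (((Finset.univ.filter fun uv : F × F =>
        uv ≠ (0, 0) ∧ (wt uv : ℤ) = q / 4 * (q + 2 ^ (m + h))).card : ℤ)
      = 2 ^ (e - 2 * h - 1) - 2 ^ (m - h - 1)) ∧
    (∀ uv : F × F, uv ≠ (0, 0) →
      (wt uv : ℤ) = q ^ 2 / 4 ∨
      (wt uv : ℤ) = q / 4 * (q - 2 ^ (m + h)) ∨
      (wt uv : ℤ) = q / 4 * (q + 2 ^ (m + h))) := by
  subst hac
  have htwo : (2 : F) = 0 := by
    have h0 : ((2 : F)) ^ e = 0 := by exact_mod_cast hF ▸ Nat.cast_card_eq_zero F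
    exact eq_zero_of_pow_eq_zero h0
  have : CharP F 2 := CharTwo.of_one_ne_zero_of_two_eq_zero one_ne_zero htwo
  have hd : 2 * h ∣ e := by
    obtain ⟨k, hk⟩ := hdvd
    rw [hk, Nat.mul_div_cancel_left _ hh0] at heven
    obtain ⟨j, hj⟩ := heven
    exact ⟨j, by rw [hk, hj]; ring⟩
  have hcard : (Fintype.card F : ℤ) = q := by rw [hF, hq]; norm_cast
  obtain ⟨h01, ψ, hψ, hfrob, hψTr⟩ := exists_addChar_trace hF Tr hTr
  have hsq (x : F) : ψ x * ψ x = 1 := by rw [hψTr]; split_ifs <;> rfl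
  let T : F × F → ℤ := fun uv ↦ if uv.2 = b then goldSum ψ h (c ^ (2 ^ h + 1)) uv.1 else 0
  obtain ⟨r, hr, hr0⟩ : ∃ r : ℤ, q = 4 * r ∧ r ≠ 0 :=
    ⟨2 ^ (e - 2), by rw [hq, ← Nat.sub_add_cancel (show 2 ≤ e by omega)]; simp; ring, by positivity⟩
  have hform : ∑ p : F × F, ψ (c ^ (2 ^ h + 1) * p.1 ^ (2 ^ h + 1) + b * p.2) = 0 := by
    rw [AddChar.sum_prod_apply_add_mul hψ (fun x ↦ c ^ (2 ^ h + 1) * x ^ (2 ^ h + 1)), if_neg hb]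
  have hDcard : 2 * ((D.card : ℤ) + 1) = q ^ 2 := by
    have hins : insert (0, 0) D = ({p | Tr (c ^ (2 ^ h + 1) * p.1 ^ (2 ^ h + 1) + b * p.2) = 0} :
        Finset (F × F)) := by
      ext p
      rcases eq_or_ne p (0, 0) with rfl | hp <;> simp_all
    have hone : (D.card : ℤ) + 1 = (insert (0, 0) D).card := by
      rw [card_insert_of_notMem (by simp [hD])]; norm_cast
    calc 2 * ((D.card : ℤ) + 1)
        = ∑ p : F × F, (1 + ψ (c ^ (2 ^ h + 1) * p.1 ^ (2 ^ h + 1) + b * p.2)) := by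
          rw [hone, hins, card_filter, Nat.cast_sum, mul_sum]
          refine sum_congr rfl fun p _ ↦ ?_
          rw [hψTr]
          split_ifs <;> rfl
      _ = q ^ 2 := by
          rw [sum_add_distrib, hform]
          simp [hcard, sq]
  have hwtT (uv : F × F) (huv : uv ≠ (0, 0)) : (wt uv : ℤ) = r * (q - T uv) := by
    obtain ⟨u, v⟩ := uv
    have hlin : ∑ p : F × F, ψ (u * p.1 + v * p.2) = 0 := by
      rw [AddChar.sum_prod_apply_add_mul hψ (fun x ↦ u * x), AddChar.sum_mul_apply_eq_ite hψ]
      split_ifs with hv hu <;> simp_all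
    have hmix : ∑ p : F × F, ψ (c ^ (2 ^ h + 1) * p.1 ^ (2 ^ h + 1) + b * p.2) *
        ψ (u * p.1 + v * p.2) = q * T (u, v) := by
      have := AddChar.sum_prod_apply_add_mul hψ
        (fun x ↦ c ^ (2 ^ h + 1) * x ^ (2 ^ h + 1) + u * x) (v + b)
      simp only [hcard, CharTwo.add_eq_zero] at this
      simp only [T, mul_ite, mul_zero]
      refine Eq.trans (sum_congr rfl fun p _ ↦ ?_) this
      rw [← AddChar.map_add_eq_mul]
      congr 1
      ring
    have h4 : 4 * (wt (u, v) : ℤ) = ∑ p : F × F,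
        (1 + ψ (c ^ (2 ^ h + 1) * p.1 ^ (2 ^ h + 1) + b * p.2)) * (1 - ψ (u * p.1 + v * p.2)) := by
      rw [hwt, hD, filter_filter, card_filter, Nat.cast_sum, mul_sum]
      refine sum_congr rfl fun p _ ↦ ?_
      rcases eq_or_ne p (0, 0) with rfl | hp
      · simp
      · rcases h01 (u * p.1 + v * p.2) with hL | hL <;>
          by_cases hQ : Tr (c ^ (2 ^ h + 1) * p.1 ^ (2 ^ h + 1) + b * p.2) = 0 <;>
          simp [hψTr, hL, hQ, hp]
    have hexp : 4 * (wt (u, v) : ℤ) = q * (q - T (u, v)) := by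
      rw [h4]
      simp only [add_mul, one_mul, mul_sub, mul_one, sum_add_distrib, sum_sub_distrib, hform, hlin,
        hmix]
      simp [hcard]
    rw [hr] at hexp ⊢
    linarith
  have hTval (uv : F × F) : T uv = 0 ∨ T uv = 2 ^ (m + h) ∨ T uv = -2 ^ (m + h) := by
    simp only [T]
    split_ifs
    · exact goldSum_eq hF hm hd hψ hfrob hsq hc _
    · exact .inl rfl
  obtain ⟨hm1, hm2, hm0⟩ := card_filter_eq_of_three_valued T (by positivity) hTval
  have hT1 : ∑ uv, T uv = q := by
    rw [Fintype.sum_prod_type]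
    simpa [T, hcard] using sum_goldSum hψ h (c ^ (2 ^ h + 1))
  have hT2 : ∑ uv, T uv ^ 2 = q ^ 2 := by
    rw [Fintype.sum_prod_type]
    simpa [T, hcard, ite_pow] using sum_goldSum_sq hψ h (c ^ (2 ^ h + 1))
  rw [hT1] at hm1
  rw [hT2] at hm2
  rw [Fintype.card_prod, Nat.cast_mul, hcard] at hm0
  obtain ⟨k, rfl⟩ : ∃ k, m = h + 1 + k := ⟨m - h - 1, by omega⟩
  have hdiff : (#{uv | T uv = 2 ^ (h + 1 + k + h)} - #{uv | T uv = -2 ^ (h + 1 + k + h)} : ℤ) =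
      2 * 2 ^ k := by
    refine mul_left_cancel₀ (pow_ne_zero (h + 1 + k + h) (two_ne_zero (α := ℤ))) (hm1.trans ?_)
    rw [hq, hm]
    ring
  have hsum : (#{uv | T uv = 2 ^ (h + 1 + k + h)} + #{uv | T uv = -2 ^ (h + 1 + k + h)} : ℤ) =
      2 ^ (2 * k + 2) := by
    refine mul_left_cancel₀ (pow_ne_zero 2 (pow_ne_zero (h + 1 + k + h) (two_ne_zero (α := ℤ))))
      (hm2.trans ?_)
    rw [hq, hm]
    ring
  have hT0 : T (0, 0) = 0 := by simp [T, hb.symm]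
  have hwt_iff (t : ℤ) (uv : F × F) (huv : uv ≠ (0, 0)) :
      (wt uv : ℤ) = r * (q - t) ↔ T uv = t := by
    rw [hwtT uv huv, mul_right_inj' hr0, sub_right_inj]
  have hcount (t : ℤ) (ht : t ≠ 0) :
      #{uv | uv ≠ (0, 0) ∧ (wt uv : ℤ) = r * (q - t)} = #{uv | T uv = t} := by
    congr 1
    ext uv
    rcases eq_or_ne uv (0, 0) with rfl | huv
    · simp [hT0, ht.symm]
    · simp [huv, hwt_iff t uv huv]
  have hcount0 : (#{uv | uv ≠ (0, 0) ∧ (wt uv : ℤ) = r * (q - 0)} : ℤ) + 1 = #{uv | T uv = 0} := by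
    have hins : insert (0, 0) ({uv | uv ≠ (0, 0) ∧ (wt uv : ℤ) = r * (q - 0)} : Finset (F × F)) =
        ({uv | T uv = 0} : Finset (F × F)) := by
      ext uv
      rcases eq_or_ne uv (0, 0) with rfl | huv
      · simp [hT0]
      · simpa [huv] using hwt_iff 0 uv huv
    rw [← hins, card_insert_of_notMem (by simp)]
    norm_cast
  have hq4 : q / 4 = r := by omega
  have hqq : q ^ 2 / 4 = r * (q - 0) := by
    rw [sub_zero, show q ^ 2 = 4 * (r * q) by rw [sq]; nth_rw 1 [hr]; ring]
    omega
  have he1 : e - 2 * h = 2 * k + 2 := by omega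
  have he2 : e - 2 * h - 1 = 2 * k + 1 := by omega
  have he3 : h + 1 + k - h - 1 = k := by omega
  have hplus (t : ℤ) : q + t = q - -t := by ring
  rw [hqq, hq4, hplus, hcount (2 ^ (h + 1 + k + h)) (by positivity),
    hcount (-2 ^ (h + 1 + k + h)) (neg_ne_zero.2 (by positivity)), he1,
    Nat.add_sub_cancel (m := 1) (n := 2 * k + 1), he3]
  have hpow : (2 : ℤ) ^ (2 * k + 2) = 2 * 2 ^ (2 * k + 1) := by ring
  refine ⟨by omega, by linarith, by linarith, by linarith, fun uv huv ↦ ?_⟩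
  simpa only [hwt_iff _ uv huv] using hTval uv
end

section
/- Assume e/h is odd and let a ∈ F_q^*. Then the number of u ∈ F_q^* such that S(a,u) = 0 equals q − 2^{e−h} − 1. -/
open Finset

lemma pow_pow_mul_eq_self {M : Type*} [Monoid M] {x : M} {n : ℕ} (hx : x ^ n = x) (k : ℕ) :
    x ^ n ^ k = x := by
  induction k with
  | zero => simp
  | succ k ih => rw [pow_succ, pow_mul, ih, hx]

/-- The elements of a field of characteristic two fixed by the `h`-th power of the Frobenius. -/
def frobeniusFixed (F : Type*) [Field F] [CharP F 2] (h : ℕ) : AddSubgroup F where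
  carrier := {x | x ^ 2 ^ h = x}
  zero_mem' := by simp
  add_mem' {x y} hx hy := by
    simp only [Set.mem_ofPred_eq] at hx hy ⊢
    rw [add_pow_char_pow, hx, hy]
  neg_mem' {x} hx := by simpa [CharTwo.neg_eq] using hx

lemma mem_frobeniusFixed {F : Type*} [Field F] [CharP F 2] {h : ℕ} {x : F} :
    x ∈ frobeniusFixed F h ↔ x ^ 2 ^ h = x := Iff.rfl

instance (F : Type*) [Field F] [CharP F 2] [DecidableEq F] (h : ℕ) :
    DecidablePred (· ∈ frobeniusFixed F h) :=
  fun x => decidable_of_iff (x ^ 2 ^ h = x) mem_frobeniusFixed.symm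

/-- In a field with `2 ^ e` elements and `h ∣ e`, the `h`-th power of the Frobenius has exactly
`2 ^ h` fixed points. -/
lemma card_frobeniusFixed {F : Type*} [Field F] [Fintype F] [DecidableEq F] [CharP F 2] {e h : ℕ}
    (hF : Fintype.card F = 2 ^ e) (hdvd : h ∣ e) :
    Fintype.card (frobeniusFixed F h) = 2 ^ h := by
  have hker := IsCyclic.card_powMonoidHom_ker (G := Fˣ) (2 ^ h - 1)
  have hgcd : (Nat.card Fˣ).gcd (2 ^ h - 1) = 2 ^ h - 1 := by
    rw [Nat.card_eq_fintype_card, Fintype.card_units, hF]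
    exact Nat.gcd_eq_right (Nat.pow_sub_one_dvd_pow_sub_one 2 hdvd)
  rw [hgcd] at hker
  have hone : 1 ≤ 2 ^ h := Nat.one_le_two_pow
  have key : ∀ x : F, x ≠ 0 → (x ^ 2 ^ h = x ↔ x ^ (2 ^ h - 1) = 1) := fun x hx => by
    rw [← Nat.sub_add_cancel hone, pow_succ, Nat.add_sub_cancel]
    exact mul_eq_right₀ hx
  have hequiv : Nat.card (powMonoidHom (2 ^ h - 1) : Fˣ →* Fˣ).ker =
      Nat.card {x : frobeniusFixed F h // x ≠ 0} := by
    refine Nat.card_congr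
      { toFun := fun u => ⟨⟨(u : Fˣ), ?_⟩, ?_⟩
        invFun := fun x => ⟨Units.mk0 (x : frobeniusFixed F h) ?_, ?_⟩
        left_inv := fun u => by ext; rfl
        right_inv := fun x => by ext; rfl }
    · have h1 : (u : Fˣ) ^ (2 ^ h - 1) = 1 := u.2
      rw [mem_frobeniusFixed, key _ (Units.ne_zero _), ← Units.val_pow_eq_pow_val, h1,
        Units.val_one]
    · exact fun h0 => Units.ne_zero (u : Fˣ) (congrArg Subtype.val h0)
    · exact fun h0 => x.2 (Subtype.ext h0)
    · have hx0 : ((x : frobeniusFixed F h) : F) ≠ 0 := fun h0 => x.2 (Subtype.ext h0)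
      rw [MonoidHom.mem_ker]
      ext
      simpa using (key _ hx0).1 x.1.2
  rw [hker, Nat.card_eq_fintype_card, Fintype.card_subtype_compl,
    Fintype.card_subtype_eq] at hequiv
  have : 0 < Fintype.card (frobeniusFixed F h) := Fintype.card_pos
  lia

section OddQuotient

variable {F : Type*} [Field F] [Fintype F] {e h : ℕ}

/-- If `e / h` is odd then `F_{2^{2h}} ∩ F_{2^e} ⊆ F_{2^h}`. -/
lemma pow_eq_self_of_pow_pow_eq_self (hF : Fintype.card F = 2 ^ e) (hdvd : h ∣ e)
    (hodd : Odd (e / h)) {x : F} (hx : (x ^ 2 ^ h) ^ 2 ^ h = x) : x ^ 2 ^ h = x := by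
  obtain ⟨k, hk⟩ := hodd
  have he : e = h * (2 * k + 1) := by rw [← hk, Nat.mul_div_cancel' hdvd]
  have h1 := FiniteField.pow_card x
  rw [hF, he, pow_mul, pow_succ, pow_mul, pow_mul] at h1
  rwa [pow_pow_mul_eq_self (by rwa [sq, pow_mul]) k] at h1

/-- If `e / h` is odd then `2 ^ h + 1` is prime to `2 ^ e - 1`, so that `x ↦ x ^ (2 ^ h + 1)` is a
permutation. -/
lemma bijective_pow_two_pow_add_one (hF : Fintype.card F = 2 ^ e) (hdvd : h ∣ e)
    (hodd : Odd (e / h)) : Function.Bijective fun x : F => x ^ (2 ^ h + 1) := by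
  have hinj : Function.Injective (powMonoidHom (2 ^ h + 1) : Fˣ →* Fˣ) := by
    rw [injective_iff_map_eq_one]
    intro u hu
    have hu1 : u ^ 2 ^ h * u = 1 := by rw [← pow_succ]; exact hu
    have hinv : u ^ 2 ^ h = u⁻¹ := eq_inv_of_mul_eq_one_left hu1
    have hfix : u ^ 2 ^ h = u := by
      have : ((u : F) ^ 2 ^ h) ^ 2 ^ h = u := by
        rw [← Units.val_pow_eq_pow_val, hinv, ← Units.val_pow_eq_pow_val, inv_pow, hinv, inv_inv]
      exact Units.ext (by simpa using pow_eq_self_of_pow_pow_eq_self hF hdvd hodd this)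
    have hsq : (u : F) ^ 2 = 1 := by
      rw [hfix] at hu1
      rw [sq, ← Units.val_mul, hu1, Units.val_one]
    have hcard : (u : F) ^ 2 ^ e = u := by rw [← hF, FiniteField.pow_card]
    ext
    rcases e with _ | e
    · have := Fintype.one_lt_card (α := F)
      lia
    · rw [← hcard, pow_succ', pow_mul, hsq, one_pow, Units.val_one]
  refine Finite.surjective_iff_bijective.1 fun a => ?_
  by_cases ha : a = 0
  · exact ⟨0, by simp [ha]⟩
  · obtain ⟨c, hc⟩ := Finite.surjective_of_injective hinj (Units.mk0 a ha)
    exact ⟨c, by simpa using congrArg Units.val hc⟩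

end OddQuotient

section CharacterSums

variable {F : Type*} [Field F] [Fintype F] [DecidableEq F] [CharP F 2] {ε : AddChar F ℤ} {h : ℕ}

/-- The character sum of the bilinear form polarizing `x ^ (2 ^ h + 1)`. -/
lemma sum_bilinear_gold (hε : ε.IsPrimitive) (hfrob : ∀ x, ε (x ^ 2 ^ h) = ε x) (x : F) :
    ∑ y, ε (x ^ 2 ^ h * y + x * y ^ 2 ^ h) =
      if (x ^ 2 ^ h) ^ 2 ^ h = x then (Fintype.card F : ℤ) else 0 := by
  have hbij : Function.Bijective fun y : F => y ^ 2 ^ h :=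
    Finite.injective_iff_bijective.1 (iterateFrobenius_inj F 2 h)
  have hterm : ∀ y, ε (x ^ 2 ^ h * y + x * y ^ 2 ^ h) =
      ε (y ^ 2 ^ h * ((x ^ 2 ^ h) ^ 2 ^ h + x)) := fun y => by
    rw [AddChar.map_add_eq_mul, ← hfrob (x ^ 2 ^ h * y), ← AddChar.map_add_eq_mul, mul_pow]
    ring_nf
  simp_rw [hterm]
  rw [hbij.sum_comp fun z => ε (z * ((x ^ 2 ^ h) ^ 2 ^ h + x)), AddChar.sum_mulShift _ hε]
  simp [CharTwo.add_eq_zero]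

/-- The square of the character sum of `x ^ (2 ^ h + 1) + b * x`, when the radical of the
polarization is the set of fixed points of the `h`-th power of the Frobenius. -/
lemma sq_sum_gold (hε : ε.IsPrimitive) (hsq : ∀ x, ε (x ^ 2) = ε x)
    (hfrob : ∀ x, ε (x ^ 2 ^ h) = ε x)
    (hfix : ∀ x : F, (x ^ 2 ^ h) ^ 2 ^ h = x → x ^ 2 ^ h = x) (b : F) :
    (∑ x, ε (x ^ (2 ^ h + 1) + b * x)) ^ 2 =
      Fintype.card F * ∑ x : frobeniusFixed F h, ε ((1 + b) * x) := by
  have hfix' : ∀ x : F, (x ^ 2 ^ h) ^ 2 ^ h = x ↔ x ∈ frobeniusFixed F h := fun x =>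
    ⟨hfix x, fun hx => by rw [mem_frobeniusFixed.1 hx, mem_frobeniusFixed.1 hx]⟩
  calc (∑ x, ε (x ^ (2 ^ h + 1) + b * x)) ^ 2
      = ∑ y, ∑ x, ε ((x + y) ^ (2 ^ h + 1) + b * (x + y)) * ε (y ^ (2 ^ h + 1) + b * y) := by
        rw [sq, mul_comm, sum_mul_sum]
        refine sum_congr rfl fun y _ => ?_
        rw [← Equiv.sum_comp (Equiv.addRight y)]
        exact sum_congr rfl fun x _ => mul_comm _ _
    _ = ∑ x, ε (x ^ (2 ^ h + 1) + b * x) * ∑ y, ε (x ^ 2 ^ h * y + x * y ^ 2 ^ h) := by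
        rw [sum_comm]
        refine sum_congr rfl fun x _ => ?_
        rw [mul_sum]
        refine sum_congr rfl fun y _ => ?_
        rw [← AddChar.map_add_eq_mul, ← AddChar.map_add_eq_mul]
        congr 1
        rw [pow_succ (x + y), add_pow_char_pow]
        linear_combination CharTwo.add_self_eq_zero (y ^ (2 ^ h + 1) + b * y)
    _ = ∑ x with x ∈ frobeniusFixed F h, ε (x ^ (2 ^ h + 1) + b * x) * Fintype.card F := by
        simp_rw [sum_bilinear_gold hε hfrob, hfix', mul_ite, mul_zero, sum_filter]
    _ = _ := by
        rw [← sum_mul, mul_comm, sum_subtype (p := (· ∈ frobeniusFixed F h)) _ (by simp)]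
        congr 1
        refine sum_congr rfl fun x _ => ?_
        rw [pow_succ, mem_frobeniusFixed.1 x.2, ← sq, AddChar.map_add_eq_mul, hsq,
          ← AddChar.map_add_eq_mul, add_mul, one_mul]

/-- The number of nonvanishing values of the character sum, times the number of fixed points of the
`h`-th power of the Frobenius, is the size of the field. -/
lemma card_sum_gold_ne_zero_mul (hε : ε.IsPrimitive) (hsq : ∀ x, ε (x ^ 2) = ε x)
    (hfrob : ∀ x, ε (x ^ 2 ^ h) = ε x)
    (hfix : ∀ x : F, (x ^ 2 ^ h) ^ 2 ^ h = x → x ^ 2 ^ h = x) :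
    #{b : F | ∑ x, ε (x ^ (2 ^ h + 1) + b * x) ≠ 0} * Fintype.card (frobeniusFixed F h) =
      Fintype.card F := by
  set T : F → ℤ := fun b => ∑ x, ε (x ^ (2 ^ h + 1) + b * x)
  set L := frobeniusFixed F h
  have hT : ∀ b, ∑ x : L, ε ((1 + b) * x) = if T b ≠ 0 then (Fintype.card L : ℤ) else 0 := by
    intro b
    have h1 : T b ^ 2 = Fintype.card F * ∑ x : L, ε ((1 + b) * x) :=
      sq_sum_gold hε hsq hfrob hfix b
    have h2 := AddChar.sum_eq_ite ((ε.mulShift (1 + b)).compAddMonoidHom L.subtype)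
    simp only [AddChar.compAddMonoidHom_apply, AddChar.mulShift_apply,
      AddSubgroup.subtype_apply] at h2
    split_ifs with hTb
    · rw [h2, if_pos]
      by_contra hne
      rw [h2, if_neg hne, mul_zero] at h1
      exact hTb (pow_eq_zero_iff two_ne_zero |>.1 h1)
    · rw [not_not.1 hTb] at h1
      simpa using h1
  have hsum : ∑ b : F, ∑ x : L, ε ((1 + b) * x) = Fintype.card F := by
    rw [sum_comm, sum_eq_single (0 : L)]
    · simp
    · intro x _ hx
      refine (Equiv.sum_comp (Equiv.addLeft (1 : F)) fun b => ε (b * x)).trans ?_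
      rw [AddChar.sum_mulShift _ hε, if_neg (by simpa using hx), Nat.cast_zero]
    · simp
  simp_rw [hT] at hsum
  rw [← sum_filter, sum_const, nsmul_eq_mul] at hsum
  exact_mod_cast hsum

end CharacterSums

/-- The additive character `x ↦ (-1) ^ Tr x` of a field with `2 ^ e` elements, with the trace
written as a polynomial. -/
lemma exists_isPrimitive_addChar_trace {F : Type*} [Field F] [Fintype F] [DecidableEq F] {e : ℕ}
    [CharP F 2] (hF : Fintype.card F = 2 ^ e) :
    ∃ ε : AddChar F ℤ, ε.IsPrimitive ∧ (∀ x, ε (x ^ 2) = ε x) ∧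
      ∀ x, ε x = if ∑ i ∈ range e, x ^ 2 ^ i = 0 then 1 else -1 := by
  let _ : Algebra (ZMod 2) F := ZMod.algebra F 2
  let σ : AddChar (ZMod 2) ℤ :=
    { toFun := fun t => if t = 0 then 1 else -1
      map_zero_eq_one' := by decide
      map_add_eq_mul' := by decide }
  have hrank : Module.finrank (ZMod 2) F = e := by
    have := Module.card_eq_pow_finrank (K := ZMod 2) (V := F)
    rw [hF, ZMod.card] at this
    exact (Nat.pow_right_injective le_rfl this).symm
  have htr : ∀ x : F, Algebra.trace (ZMod 2) F x = 0 ↔ ∑ i ∈ range e, x ^ 2 ^ i = 0 := by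
    intro x
    have := FiniteField.algebraMap_trace_eq_sum_pow (ZMod 2) F x
    rw [hrank, Nat.card_zmod] at this
    rw [← this, map_eq_zero_iff _ (algebraMap (ZMod 2) F).injective]
  let ε : AddChar F ℤ := σ.compAddMonoidHom (Algebra.trace (ZMod 2) F).toAddMonoidHom
  have hε : ∀ x, ε x = if Algebra.trace (ZMod 2) F x = 0 then 1 else -1 := fun _ => rfl
  refine ⟨ε, AddChar.IsPrimitive.of_ne_one (AddChar.ne_one_iff.2 ?_), fun x => ?_, fun x => ?_⟩
  · obtain ⟨x, hx⟩ := Algebra.trace_surjective (ZMod 2) F 1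
    exact ⟨x, by rw [hε, hx]; decide⟩
  · have hpow : Algebra.trace (ZMod 2) F (x ^ 2) = Algebra.trace (ZMod 2) F x := by
      have := Algebra.trace_eq_of_algEquiv (FiniteField.frobeniusAlgEquivOfAlgebraic (ZMod 2) F) x
      simpa using this
    rw [hε, hε, hpow]
  · simp only [hε, htr]

/-- If `e/h` is odd and `a ∈ F_q^*`, the number of `u ∈ F_q^*` with `S(a,u) = 0`
equals `q − 2^{e−h} − 1`. -/
theorem stmt_13
    (e h : ℕ) (hdvd : h ∣ e) (hh0 : 0 < h) (hhe : h < e)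
    (hodd : Odd (e / h))
    (F : Type) [Field F] [Fintype F] [DecidableEq F]
    (hF : Fintype.card F = 2 ^ e)
    (q : ℤ) (hq : q = 2 ^ e)
    (Tr : F → F) (hTr : ∀ x, Tr x = ∑ i ∈ Finset.range e, x ^ 2 ^ i)
    (S : F → F → ℤ)
    (hS : ∀ a b : F, S a b = ∑ x : F,
        if Tr (a * x ^ (2 ^ h + 1) + b * x) = 0 then (1 : ℤ) else -1)
    (a : F) (ha : a ≠ 0) :
    (((Finset.univ.filter fun u : F => u ≠ 0 ∧ S a u = 0).card : ℤ))
      = q - 2 ^ (e - h) - 1 := by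
  have : CharP F 2 := charP_of_card_eq_prime_pow (f := e) hF
  obtain ⟨ε, hprim, hsq, hε⟩ := exists_isPrimitive_addChar_trace hF
  have hbij := bijective_pow_two_pow_add_one hF hdvd hodd
  obtain ⟨c, hc⟩ := hbij.surjective a
  have hc0 : c ≠ 0 := by
    rintro rfl
    exact ha (by simpa using hc.symm)
  have hpow : ∀ n x, ε (x ^ 2 ^ n) = ε x := fun n x => by
    induction n with
    | zero => simp
    | succ n ih => rw [pow_succ, pow_mul, hsq, ih]
  have hSε : ∀ b, S a (c * b) = ∑ x, ε (x ^ (2 ^ h + 1) + b * x) := fun b => by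
    rw [hS, ← Equiv.sum_comp (Equiv.mulLeft₀ c hc0) fun x => ε (x ^ (2 ^ h + 1) + b * x)]
    refine sum_congr rfl fun x _ => ?_
    have harg : a * x ^ (2 ^ h + 1) + c * b * x = (c * x) ^ (2 ^ h + 1) + b * (c * x) := by
      rw [mul_pow, ← hc]
      ring
    rw [Equiv.mulLeft₀_apply, hε, hTr, harg]
  have hS0 : S a 0 = 0 := by
    have h0 := hSε 0
    have h1 := AddChar.sum_mulShift 1 hprim
    simp only [mul_zero, zero_mul, add_zero, hbij.sum_comp fun x => ε x] at h0
    simp only [mul_one, one_ne_zero, if_false, Nat.cast_zero] at h1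
    rw [h0, h1]
  have hne : #{u | S a u ≠ 0} * 2 ^ h = 2 ^ (e - h) * 2 ^ h := by
    rw [← pow_add, Nat.sub_add_cancel hhe.le, ← card_frobeniusFixed hF hdvd, ← hF,
      ← card_sum_gold_ne_zero_mul hprim hsq (hpow h)
        fun x => pow_eq_self_of_pow_pow_eq_self hF hdvd hodd]
    congr 1
    refine (card_equiv (Equiv.mulLeft₀ c hc0) fun b => ?_).symm
    simp [hSε]
  have hne' := Nat.eq_of_mul_eq_mul_right (by positivity) hne
  have hsplit := card_filter_add_card_filter_not (s := univ) fun u => S a u = 0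
  have herase : ({u | u ≠ 0 ∧ S a u = 0} : Finset F) = ({u | S a u = 0} : Finset F).erase 0 := by
    ext u; simp
  have hcard := card_erase_add_one (s := ({u | S a u = 0} : Finset F)) (a := 0) (by simpa)
  rw [hne', card_univ, hF] at hsplit
  rw [herase, hq]
  zify at hsplit hcard
  linarith
end

section
/- Assume e/h is even and let a ∈ F_q^* be a (2^h+1)-th power in F_q^* (i.e., a = c^{2^h+1} for some c ∈ F_q^*). Define f(x) = a^{2^h}·x^{2^{2h}} + a·x. Then the number of u ∈ F_q^* such that the equation f(x) = u^{2^h} has no solution x ∈ F_q equals q − 2^{e−2h}. -/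
open Polynomial in
/-- A finite field of order `p ^ n` contains exactly `p ^ m` solutions of `x ^ p ^ m = x` when
`m ∣ n`. -/
theorem FiniteField.natCard_pow_eq_self {F : Type*} [Field F] [Fintype F] {p m n : ℕ}
    [Fact p.Prime] [CharP F p] (hF : Fintype.card F = p ^ n) (hm : m ≠ 0) (hmn : m ∣ n) :
    Nat.card {x : F // x ^ p ^ m = x} = p ^ m := by
  have hp : 1 < p := (Fact.out : p.Prime).one_lt
  have hsplit : (X ^ p ^ m - X : F[X]).Splits := by
    refine (Polynomial.splits_X_pow_nat_card_sub_X (K := F)).of_dvd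
      (FiniteField.X_pow_card_sub_X_ne_zero F Finite.one_lt_card) ?_
    rw [Nat.card_eq_fintype_card, hF]
    exact dvd_pow_pow_sub_self_of_dvd hmn
  have hcard := card_rootSet_eq_natDegree (F := F) (K := F)
    (galois_poly_separable p (p ^ m) (dvd_pow_self p hm)) (by simpa using hsplit)
  rw [FiniteField.X_pow_card_pow_sub_X_natDegree_eq F hm hp, ← Nat.card_eq_fintype_card] at hcard
  refine (Nat.card_congr (Equiv.subtypeEquivRight fun x => ?_)).trans hcard
  rw [mem_rootSet]
  simp [FiniteField.X_pow_card_pow_sub_X_ne_zero F hm hp, sub_eq_zero]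

/-- In a finite field of order `p ^ n`, the map `x ↦ x ^ p ^ m - x` has image of order
`p ^ (n - m)` when `m ∣ n`. -/
theorem FiniteField.natCard_range_pow_sub_self {F : Type*} [Field F] [Fintype F] {p m n : ℕ}
    [Fact p.Prime] [CharP F p] (hF : Fintype.card F = p ^ n) (hm : m ≠ 0) (hmn : m ∣ n) :
    Nat.card (Set.range fun x : F => x ^ p ^ m - x) = p ^ (n - m) := by
  have hp : p.Prime := Fact.out
  have hn : n ≠ 0 := by
    rintro rfl
    have := Fintype.one_lt_card (α := F)
    simp_all
  have hle : m ≤ n := Nat.le_of_dvd (Nat.pos_of_ne_zero hn) hmn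
  let g : F →+ F := (iterateFrobenius F p m : F →+ F) - AddMonoidHom.id F
  have hg (x : F) : g x = x ^ p ^ m - x := by simp [g, iterateFrobenius_def]
  have hker : Nat.card g.ker = p ^ m := by
    rw [← FiniteField.natCard_pow_eq_self hF hm hmn]
    refine Nat.card_congr (Equiv.subtypeEquivRight fun x => ?_)
    rw [AddMonoidHom.mem_ker, hg, sub_eq_zero]
  have hmul := g.ker.card_mul_index
  rw [AddSubgroup.index_ker, hker, Nat.card_eq_fintype_card (α := F), hF,
    ← Nat.add_sub_of_le hle, pow_add] at hmul
  rw [← Nat.eq_of_mul_eq_mul_left (pow_pos hp.pos m) hmul]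
  refine Nat.card_congr (Equiv.setCongr ?_)
  ext y
  simp [hg]

/-- If `e/h` is even and `a ∈ F_q^*` is a `(2^h+1)`-th power, with
`f(x) = a^{2^h} x^{2^{2h}} + a x`, then the number of `u ∈ F_q^*` such that
`f(x) = u^{2^h}` has no solution in `F_q` equals `q − 2^{e−2h}`. -/
theorem stmt_14
    (e h : ℕ) (hdvd : h ∣ e) (hh0 : 0 < h) (hhe : h < e)
    (heven : Even (e / h))
    (F : Type) [Field F] [Fintype F] [DecidableEq F]
    (hF : Fintype.card F = 2 ^ e)
    (q : ℤ) (hq : q = 2 ^ e)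
    (a : F) (ha : a ≠ 0)
    (c : F) (hc : c ≠ 0) (hac : a = c ^ (2 ^ h + 1))
    (f : F → F) (hf : ∀ x, f x = a ^ 2 ^ h * x ^ 2 ^ (2 * h) + a * x) :
    (((Finset.univ.filter fun u : F =>
        u ≠ 0 ∧ ∀ x : F, f x ≠ u ^ 2 ^ h).card : ℤ))
      = q - 2 ^ (e - 2 * h) := by
  have : Fact (Nat.Prime 2) := ⟨Nat.prime_two⟩
  have : CharP F 2 := charP_of_card_eq_prime_pow hF
  have h2h : 2 * h ∣ e := by
    obtain ⟨k, hk⟩ := even_iff_two_dvd.mp heven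
    exact ⟨k, by rw [← Nat.div_mul_cancel hdvd, hk]; ring⟩
  have hcQ : c ^ 2 ^ h ≠ 0 := pow_ne_zero _ hc
  have hfac (x : F) : f x = c ^ 2 ^ h * ((c * x) ^ 2 ^ (2 * h) - c * x) := by
    rw [hf, hac, CharTwo.sub_eq_add, two_mul h, pow_add 2 h h]
    ring
  let φ : F → F := fun u => (u / c) ^ 2 ^ h
  have hφ : Function.Bijective φ := by
    refine Finite.injective_iff_bijective.mp fun u v huv => ?_
    exact (div_left_inj' hc).mp (iterateFrobenius_inj F 2 h (by
      simpa only [iterateFrobenius_def] using huv))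
  have hsolv (u : F) : (∃ x, f x = u ^ 2 ^ h) ↔
      φ u ∈ Set.range fun y : F => y ^ 2 ^ (2 * h) - y := by
    simp only [φ, div_pow, Set.mem_range, eq_div_iff hcQ, hfac]
    constructor
    · rintro ⟨x, hx⟩
      exact ⟨c * x, by rw [← hx, mul_comm]⟩
    · rintro ⟨y, hy⟩
      exact ⟨y / c, by rw [mul_div_cancel₀ y hc, ← hy, mul_comm]⟩
  have hcount : (Finset.univ.filter fun u : F => ∃ x, f x = u ^ 2 ^ h).card
      = 2 ^ (e - 2 * h) := by
    rw [← FiniteField.natCard_range_pow_sub_self hF (by omega) h2h, ← Fintype.card_subtype,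
      ← Nat.card_eq_fintype_card]
    exact Nat.card_congr ((Equiv.ofBijective φ hφ).subtypeEquiv hsolv)
  have hzero (u : F) : (u ≠ 0 ∧ ∀ x : F, f x ≠ u ^ 2 ^ h) ↔ ¬ ∃ x, f x = u ^ 2 ^ h := by
    rw [not_exists, and_iff_right_iff_imp]
    rintro hu rfl
    exact hu 0 (by simp [hf])
  simp_rw [hzero]
  have htotal := Finset.card_filter_add_card_filter_not (s := (Finset.univ : Finset F))
    (fun u : F => ∃ x, f x = u ^ 2 ^ h)
  rw [hcount, Finset.card_univ, hF] at htotal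
  rw [hq, eq_sub_iff_add_eq']
  exact_mod_cast htotal
end

section
/- If e/d is odd, then for every a ∈ F_q^*, Σ_{x ∈ F_q} χ₁(a·x^{2^α+1}) = 0. -/
theorem coprime_two_pow_add_one_two_pow_sub_one {e α : ℕ} (he : 0 < e)
    (hodd : Odd (e / Nat.gcd e α)) : Nat.Coprime (2 ^ α + 1) (2 ^ e - 1) := by
  have hgcd : Nat.gcd (2 * α) e ∣ α := by
    have hd : 0 < Nat.gcd e α := Nat.gcd_pos_of_pos_left _ he
    obtain ⟨e', α', hcop, h1, h2⟩ := Nat.exists_coprime e α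
    set d := Nat.gcd e α
    have h3 : e / d = e' := by rw [h1, Nat.mul_div_cancel _ hd]
    rw [h3] at hodd
    rw [h1, h2, ← mul_assoc, Nat.gcd_mul_right]
    have h4 : Nat.Coprime (2 * α') e' :=
      Nat.Coprime.mul_left (Nat.coprime_two_left.mpr hodd) hcop.symm
    rw [h4.gcd_eq_one, one_mul]
    exact dvd_mul_left _ _
  have hle : 1 ≤ 2 ^ α := Nat.one_le_two_pow
  obtain ⟨g, hg⟩ : ∃ g, g = Nat.gcd (2 ^ α + 1) (2 ^ e - 1) := ⟨_, rfl⟩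
  have hg1 : g ∣ 2 ^ α + 1 := hg ▸ Nat.gcd_dvd_left _ _
  have hg2 : g ∣ 2 ^ e - 1 := hg ▸ Nat.gcd_dvd_right _ _
  have hg3 : g ∣ 2 ^ (2 * α) - 1 := by
    have h : 2 ^ (2 * α) - 1 = (2 ^ α + 1) * (2 ^ α - 1) := by
      rw [← Nat.sq_sub_sq, ← pow_mul, mul_comm 2 α, one_pow]
    exact h ▸ hg1.mul_right _
  have hg4 : g ∣ 2 ^ α - 1 := by
    have h := Nat.dvd_gcd hg3 hg2
    rw [Nat.pow_sub_one_gcd_pow_sub_one] at h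
    exact h.trans (Nat.pow_sub_one_dvd_pow_sub_one 2 hgcd)
  have hg5 : g ∣ 2 := by
    have h := Nat.dvd_sub hg1 hg4
    rwa [show 2 ^ α + 1 - (2 ^ α - 1) = 2 by omega] at h
  rw [Nat.Coprime, ← hg]
  refine ((Nat.dvd_prime Nat.prime_two).mp hg5).resolve_right fun h => ?_
  rw [h] at hg2
  have h2 : 2 ∣ 2 ^ e := dvd_pow_self 2 he.ne'
  have : 1 ≤ 2 ^ e := Nat.one_le_two_pow
  omega

theorem FiniteField.pow_bijective_of_coprime {F : Type*} [Field F] [Fintype F] {n : ℕ}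
    (hn : n ≠ 0) (h : Nat.Coprime n (Fintype.card F - 1)) :
    Function.Bijective fun x : F => x ^ n := by
  refine Finite.injective_iff_bijective.mp fun x y hxy => ?_
  rcases eq_or_ne y 0 with rfl | hy
  · rwa [zero_pow hn, pow_eq_zero_iff hn] at hxy
  have hx : x ≠ 0 := by
    rintro rfl
    rw [zero_pow hn] at hxy
    exact pow_ne_zero n hy hxy.symm
  have h1 : (x / y) ^ n = 1 := by rw [div_pow, hxy, div_self (pow_ne_zero n hy)]
  have h2 := FiniteField.pow_card_sub_one_eq_one (x / y) (div_ne_zero hx hy)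
  have h3 : (x / y) ^ Nat.gcd n (Fintype.card F - 1) = 1 := pow_gcd_eq_one.mpr ⟨h1, h2⟩
  rw [h.gcd_eq_one, pow_one] at h3
  exact (div_eq_one_iff_eq hy).mp h3

open Polynomial in
theorem exists_sum_pow_two_pow_ne_zero {F : Type*} [Field F] [Fintype F] {e : ℕ} (he : 0 < e)
    (hF : Fintype.card F = 2 ^ e) : ∃ c : F, ∑ i ∈ Finset.range e, c ^ 2 ^ i ≠ 0 := by
  by_contra! h
  have hp : (∑ i ∈ Finset.range e, X ^ 2 ^ i : F[X]) = 0 := by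
    refine eq_zero_of_natDegree_lt_card_of_eval_eq_zero _ Function.injective_id
      (fun c => by simpa [eval_finsetSum] using h c) ?_
    rw [hF]
    refine (natDegree_sum_le_of_forall_le (n := 2 ^ (e - 1)) _ _ fun i hi => ?_).trans_lt
      (Nat.pow_lt_pow_right one_lt_two (by omega))
    rw [natDegree_X_pow]
    exact Nat.pow_le_pow_right two_pos (Nat.le_sub_one_of_lt (Finset.mem_range.mp hi))
  have hc := congrArg (coeff · 1) hp
  simp only [finsetSum_coeff, coeff_X_pow, coeff_zero] at hc
  rw [Finset.sum_eq_single 0] at hc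
  · simp at hc
  · intro i _ hi
    rw [if_neg (Nat.one_lt_two_pow hi).ne]
  · simp [he.ne']

theorem stmt_15
    (e α : ℕ) (he : 0 < e) (hα : 0 < α)
    (d : ℕ) (hd : d = Nat.gcd e α)
    (hodd : Odd (e / d))
    (F : Type) [Field F] [Fintype F] [DecidableEq F]
    (hF : Fintype.card F = 2 ^ e)
    (Tr : F → F) (hTr : ∀ x, Tr x = ∑ i ∈ Finset.range e, x ^ 2 ^ i)
    (χ : F → ℤ) (hχ : ∀ x, χ x = if Tr x = 0 then 1 else -1)
    (a : F) (ha : a ≠ 0) :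
    ∑ x : F, χ (a * x ^ (2 ^ α + 1)) = 0 := by
  subst hd
  have hchar : CharP F 2 := by
    have : ringChar F = 2 := by
      have hr : (ringChar F).Prime := CharP.char_is_prime F (ringChar F)
      have h2 : ((Fintype.card F : ℕ) : F) = 0 := FiniteField.cast_card_eq_zero F
      have h3 := (ringChar.spec F _).mp h2
      rw [hF] at h3
      exact (Nat.prime_dvd_prime_iff_eq hr Nat.prime_two).mp (hr.dvd_of_dvd_pow h3)
    exact ringChar.of_eq this
  have hadd (x y : F) : Tr (x + y) = Tr x + Tr y := by
    simp only [hTr, add_pow_char_pow, Finset.sum_add_distrib]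
  have hTr01 (x : F) : Tr x = 0 ∨ Tr x = 1 := by
    have hsq : Tr x ^ 2 = Tr x := by
      have h1 : Tr x ^ 2 = ∑ i ∈ Finset.range e, x ^ 2 ^ (i + 1) := by
        rw [hTr, sum_pow_char]
        simp only [← pow_mul, ← pow_succ]
      have h2 := Finset.sum_range_succ' (fun i => x ^ 2 ^ i) e
      rw [Finset.sum_range_succ, ← h1, ← hTr, ← hF, FiniteField.pow_card] at h2
      simpa using h2.symm
    rcases eq_or_ne (Tr x) 0 with h | h
    · exact Or.inl h
    · exact Or.inr (mul_left_cancel₀ h (by rw [← sq, hsq, mul_one]))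
  obtain ⟨c, hc⟩ := exists_sum_pow_two_pow_ne_zero he hF
  rw [← hTr] at hc
  have hneg (x : F) : χ (x + c) = -χ x := by
    have hc1 := (hTr01 c).resolve_left hc
    rcases hTr01 x with h | h <;> simp [hχ, hadd, hc1, h, CharTwo.add_self_eq_zero]
  have hsum : ∑ x : F, χ x = 0 := by
    have h := Equiv.sum_comp (Equiv.addRight c) χ
    simp only [Equiv.coe_addRight, hneg, Finset.sum_neg_distrib] at h
    omega
  have hbij : Function.Bijective fun x : F => a * x ^ (2 ^ α + 1) :=
    (mulLeft_bijective₀ a ha).comp (FiniteField.pow_bijective_of_coprime (Nat.succ_ne_zero _)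
      (hF ▸ coprime_two_pow_add_one_two_pow_sub_one he hodd))
  rw [← hsum]
  exact hbij.sum_comp χ
end

section
/- Let e and α be positive integers and d = gcd(e, α). Then gcd(2^α + 1, 2^e − 1) = 1 if e/d is odd, and gcd(2^α + 1, 2^e − 1) = 2^d + 1 if e/d is even. -/
theorem coprime_two_pow_add_one_two_pow_sub_one_s19 {d n : ℕ} (hd : d ≠ 0) (h : d ∣ n) :
    Nat.Coprime (2 ^ n + 1) (2 ^ d - 1) := by
  have hodd : Odd (2 ^ d - 1) :=
    Nat.Even.sub_odd Nat.one_le_two_pow (Nat.even_pow.2 ⟨even_two, hd⟩) odd_one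
  have hdvd : 2 ^ d - 1 ∣ 2 ^ n - 1 := Nat.pow_sub_one_dvd_pow_sub_one 2 h
  have hsum : 2 ^ n + 1 = (2 ^ n - 1) + 2 := by
    have := Nat.one_le_two_pow (n := n)
    omega
  obtain ⟨k, hk⟩ := hdvd
  rw [hsum, hk, Nat.coprime_mul_left_add_left]
  exact (Nat.coprime_two_left).2 hodd

theorem gcd_two_pow_add_one_dvd (m n : ℕ) :
    Nat.gcd (2 ^ n + 1) (2 ^ m - 1) ∣ 2 ^ Nat.gcd (2 * n) m - 1 := by
  rw [← Nat.pow_sub_one_gcd_pow_sub_one]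
  refine Nat.gcd_dvd_gcd_of_dvd_left _ ⟨2 ^ n - 1, ?_⟩
  rw [← Nat.sq_sub_sq, one_pow, ← pow_mul, mul_comm]

/-- For positive integers `e, α` with `d = gcd(e,α)`:
`gcd(2^α+1, 2^e-1) = 1` if `e/d` is odd, and `gcd(2^α+1, 2^e-1) = 2^d+1` if `e/d` is even. -/
theorem stmt_19
    (e α : ℕ) (he : 0 < e) (hα : 0 < α)
    (d : ℕ) (hd : d = Nat.gcd e α) :
    (Odd (e / d) → Nat.gcd (2 ^ α + 1) (2 ^ e - 1) = 1) ∧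
    (Even (e / d) → Nat.gcd (2 ^ α + 1) (2 ^ e - 1) = 2 ^ d + 1) := by
  have hd0 : 0 < d := hd ▸ Nat.gcd_pos_of_pos_left α he
  obtain ⟨m, n, hmn, rfl, rfl⟩ : ∃ m n, Nat.Coprime m n ∧ e = d * m ∧ α = d * n := by
    obtain ⟨m, n, hmn, h₁, h₂⟩ := Nat.exists_coprime e α
    exact ⟨m, n, hmn, by rw [hd, mul_comm]; exact h₁, by rw [hd, mul_comm]; exact h₂⟩
  clear hd
  rw [Nat.mul_div_cancel_left m hd0]
  have hcop := coprime_two_pow_add_one_two_pow_sub_one_s19 hd0.ne' (dvd_mul_right d n)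
  have hdvd := gcd_two_pow_add_one_dvd (d * m) (d * n)
  rw [mul_left_comm, Nat.gcd_mul_left] at hdvd
  constructor
  · intro hm
    rw [Nat.Coprime.mul_left (Nat.coprime_two_left.2 hm) hmn.symm, mul_one] at hdvd
    exact Nat.eq_one_of_dvd_coprimes hcop (Nat.gcd_dvd_left _ _) hdvd
  · intro hm
    have hn : Odd n := by
      rw [← Nat.coprime_two_left]
      exact hmn.coprime_dvd_left hm.two_dvd
    have hfactor : 2 ^ (d * 2) - 1 = (2 ^ d + 1) * (2 ^ d - 1) := by
      rw [← Nat.sq_sub_sq, one_pow, ← pow_mul]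
    rw [Nat.Coprime.gcd_mul_right_cancel 2 hmn.symm, Nat.gcd_eq_left hm.two_dvd, hfactor] at hdvd
    apply Nat.dvd_antisymm
    · exact (hcop.coprime_dvd_left (Nat.gcd_dvd_left _ _)).dvd_of_dvd_mul_right hdvd
    · refine Nat.dvd_gcd ?_ ?_
      · simpa [pow_mul] using hn.nat_add_dvd_pow_add_pow (2 ^ d) 1
      · exact (Dvd.intro _ hfactor.symm).trans
          (Nat.pow_sub_one_dvd_pow_sub_one 2 (mul_dvd_mul_left d hm.two_dvd))
end
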